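/- Let n ∈ ℕ, K ≥ 1, r > 0, δ > 0, and let f : ℝⁿ → ℝⁿ be Lipschitz on ℝⁿ with constant L > 0, with f(0) = 0 and ‖f(y)‖ ≤ Q for all y ∈ B_{4Kr}. Let φ be a global solution map of ẋ = f(x) with ‖φ(t,y)‖ ≤ K‖y‖ for all t ≥ 0 and all y ∈ B_{2Kr}. Choose T > 0 with T < min(2Kr/Q, 1/L), an integer N > δ/T, and k ∈ ℕ such that c(k) < K. Then for every x ∈ B_r, every i ∈ {0,…,N−1}, and every t ∈ [iT, iT+T] with t ≤ δ: ‖G_iᵏ(t−iT, x) − φ(t,x)‖ ≤ c(k)·‖x‖. -/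

import Mathlib

/-- The Picard operator acting on functions `z : ℝ × ℝⁿ → ℝⁿ`:
`(P z)(t,x) = x + ∫₀ᵗ f(z(s,x)) ds`. -/
noncomputable def picardT {n : ℕ} (f : EuclideanSpace ℝ (Fin n) → EuclideanSpace ℝ (Fin n))
    (z : ℝ → EuclideanSpace ℝ (Fin n) → EuclideanSpace ℝ (Fin n)) :
    ℝ → EuclideanSpace ℝ (Fin n) → EuclideanSpace ℝ (Fin n) :=
  fun t x => x + ∫ s in (0:ℝ)..t, f (z s x)

/-- The extended Picard iterates: `G₀ᵏ = Pᵏ 0`, `G_{i+1}ᵏ(t,x) = (Pᵏ 0)(t, G_iᵏ(T,x))`. -/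
noncomputable def GIter {n : ℕ} (f : EuclideanSpace ℝ (Fin n) → EuclideanSpace ℝ (Fin n))
    (T : ℝ) (k : ℕ) : ℕ → ℝ → EuclideanSpace ℝ (Fin n) → EuclideanSpace ℝ (Fin n)
  | 0 => (picardT f)^[k] 0
  | (i + 1) => fun t x => (picardT f)^[k] 0 t (GIter f T k i T x)

/-- `c(k) = Σ_{i=0}^{N−1} (e^{TL} + K·(TL)ᵏ)ⁱ · K² · (TL)ᵏ`. -/
noncomputable def cval (K T L : ℝ) (N k : ℕ) : ℝ :=
  ∑ i ∈ Finset.range N, (Real.exp (T * L) + K * (T * L) ^ k) ^ i * (K ^ 2 * (T * L) ^ k)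

theorem continuous_picardT_iterate {n : ℕ}
    {f : EuclideanSpace ℝ (Fin n) → EuclideanSpace ℝ (Fin n)} (hf : Continuous f)
    (k : ℕ) (y : EuclideanSpace ℝ (Fin n)) :
    Continuous fun t => (picardT f)^[k] 0 t y := by
  induction k with
  | zero => exact continuous_const
  | succ k ih =>
    simp only [Function.iterate_succ_apply', picardT]
    exact continuous_const.add (intervalIntegral.continuous_primitive
      (fun a b => (hf.comp ih).intervalIntegrable a b) 0)

/-- Picard iterates started at `0` approach a solution `u` bounded by `C` on `[0,T]` geometrically
with ratio `T * L`. -/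
theorem norm_picardT_iterate_sub_le {n : ℕ}
    {f : EuclideanSpace ℝ (Fin n) → EuclideanSpace ℝ (Fin n)} {L T C : ℝ} (hL : 0 ≤ L)
    (hf : Continuous f)
    (hfL : ∀ y z : EuclideanSpace ℝ (Fin n), ‖f y - f z‖ ≤ L * ‖y - z‖)
    {u : ℝ → EuclideanSpace ℝ (Fin n)} {y : EuclideanSpace ℝ (Fin n)} (hu0 : u 0 = y)
    (hu : ∀ t ≥ (0 : ℝ), HasDerivAt u (f (u t)) t) (huC : ∀ t ≥ (0 : ℝ), ‖u t‖ ≤ C)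
    (k : ℕ) {t : ℝ} (ht : t ∈ Set.Icc 0 T) :
    ‖(picardT f)^[k] 0 t y - u t‖ ≤ C * (T * L) ^ k := by
  have hC : 0 ≤ C := (norm_nonneg _).trans (huC 0 le_rfl)
  induction k generalizing t with
  | zero => simpa using huC t ht.1
  | succ k ih =>
    have hT : 0 ≤ T := ht.1.trans ht.2
    have hint₁ : IntervalIntegrable (fun s => f ((picardT f)^[k] 0 s y)) MeasureTheory.volume 0 t :=
      (hf.comp (continuous_picardT_iterate hf k y)).intervalIntegrable 0 t
    have hucont : ContinuousOn u (Set.uIcc 0 t) := fun s hs =>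
      (hu s (by rw [Set.uIcc_of_le ht.1] at hs; exact hs.1)).continuousAt.continuousWithinAt
    have hint₂ : IntervalIntegrable (fun s => f (u s)) MeasureTheory.volume 0 t :=
      (hf.comp_continuousOn hucont).intervalIntegrable
    have hut : u t = y + ∫ s in (0 : ℝ)..t, f (u s) := by
      rw [intervalIntegral.integral_eq_sub_of_hasDerivAt (f := u) _ hint₂, hu0]
      · abel
      · intro s hs
        rw [Set.uIcc_of_le ht.1] at hs
        exact hu s hs.1
    rw [Function.iterate_succ_apply', picardT, hut, add_sub_add_left_eq_sub,
      ← intervalIntegral.integral_sub hint₁ hint₂]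
    calc ‖∫ s in (0 : ℝ)..t, (f ((picardT f)^[k] 0 s y) - f (u s))‖
        ≤ L * (C * (T * L) ^ k) * |t - 0| := by
          refine intervalIntegral.norm_integral_le_of_norm_le_const fun s hs => ?_
          rw [Set.uIoc_of_le ht.1] at hs
          exact (hfL _ _).trans
            (mul_le_mul_of_nonneg_left (ih ⟨hs.1.le, hs.2.trans ht.2⟩) hL)
      _ = L * (C * (T * L) ^ k) * t := by rw [sub_zero, abs_of_nonneg ht.1]
      _ ≤ L * (C * (T * L) ^ k) * T := by
          refine mul_le_mul_of_nonneg_left ht.2 ?_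
          positivity
      _ = C * (T * L) ^ (k + 1) := by ring

/-- One step of length `T`, restarted at `g` instead of at `z`. -/
theorem norm_picardT_iterate_sub_flow_le {n : ℕ}
    {f : EuclideanSpace ℝ (Fin n) → EuclideanSpace ℝ (Fin n)} {K L T : ℝ}
    (hL : 0 ≤ L)
    (hfL : ∀ y z : EuclideanSpace ℝ (Fin n), ‖f y - f z‖ ≤ L * ‖y - z‖)
    {φ : ℝ → EuclideanSpace ℝ (Fin n) → EuclideanSpace ℝ (Fin n)}
    (hφ0 : ∀ x, φ 0 x = x)
    (hφd : ∀ x : EuclideanSpace ℝ (Fin n), ∀ t ≥ (0 : ℝ),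
      HasDerivAt (fun s => φ s x) (f (φ t x)) t)
    {g : EuclideanSpace ℝ (Fin n)} (hg : ∀ t ≥ (0 : ℝ), ‖φ t g‖ ≤ K * ‖g‖)
    (z : EuclideanSpace ℝ (Fin n)) (k : ℕ) {t : ℝ} (ht : t ∈ Set.Icc 0 T) :
    ‖(picardT f)^[k] 0 t g - φ t z‖ ≤
      K * ‖g‖ * (T * L) ^ k + Real.exp (T * L) * ‖g - z‖ := by
  have hlip : LipschitzWith L.toNNReal f := LipschitzWith.of_dist_le_mul fun y z => by
    rw [dist_eq_norm, dist_eq_norm, Real.coe_toNNReal _ hL]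
    exact hfL y z
  have hcont : ∀ x, ContinuousOn (fun s => φ s x) (Set.Icc 0 T) := fun x s hs =>
    (hφd x s hs.1).continuousAt.continuousWithinAt
  have hgron : ‖φ t g - φ t z‖ ≤ Real.exp (T * L) * ‖g - z‖ := by
    have h := dist_le_of_trajectories_ODE (v := fun _ => f) (fun _ => hlip) (hcont g)
      (fun s hs => (hφd g s hs.1).hasDerivWithinAt) (hcont z)
      (fun s hs => (hφd z s hs.1).hasDerivWithinAt) le_rfl t ht
    rw [Real.coe_toNNReal _ hL, hφ0, hφ0, dist_eq_norm, dist_eq_norm, sub_zero] at h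
    refine h.trans ?_
    rw [mul_comm, mul_comm L]
    gcongr
    exact ht.2
  calc ‖(picardT f)^[k] 0 t g - φ t z‖
      ≤ ‖(picardT f)^[k] 0 t g - φ t g‖ + ‖φ t g - φ t z‖ := norm_sub_le_norm_sub_add_norm_sub _ _ _
    _ ≤ _ := add_le_add (norm_picardT_iterate_sub_le hL hlip.continuous hfL (hφ0 g) (hφd g) hg k ht)
        hgron

theorem cval_mono {K T L : ℝ} (hK : 0 ≤ K) (hT : 0 ≤ T) (hL : 0 ≤ L) (k : ℕ) :
    Monotone fun N => cval K T L N k := fun M N h =>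
  Finset.sum_le_sum_of_subset_of_nonneg (Finset.range_mono h) fun i _ _ => by positivity

theorem cval_succ (K T L : ℝ) (N k : ℕ) :
    cval K T L (N + 1) k =
      (Real.exp (T * L) + K * (T * L) ^ k) * cval K T L N k + K ^ 2 * (T * L) ^ k := by
  simp only [cval, Finset.sum_range_succ', Finset.mul_sum, pow_zero, one_mul]
  congr 1
  exact Finset.sum_congr rfl fun i _ => by ring

/-- convergence of the extended Picard iteration,
`‖G_iᵏ(t−iT, x) − φ(t,x)‖ ≤ c(k)·‖x‖` on `[0,δ]`. -/
theorem extended_picard_convergence {n : ℕ} (K r δ L Q T : ℝ) (hK : 1 ≤ K) (hr : 0 < r)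
    (hδ : 0 < δ) (hL : 0 < L)
    (f : EuclideanSpace ℝ (Fin n) → EuclideanSpace ℝ (Fin n))
    (hfL : ∀ y z : EuclideanSpace ℝ (Fin n), ‖f y - f z‖ ≤ L * ‖y - z‖)
    (hf0 : f 0 = 0)
    (hfQ : ∀ y ∈ Metric.closedBall (0 : EuclideanSpace ℝ (Fin n)) (4 * K * r), ‖f y‖ ≤ Q)
    (φ : ℝ → EuclideanSpace ℝ (Fin n) → EuclideanSpace ℝ (Fin n))
    (hφ0 : ∀ x, φ 0 x = x)
    (hφd : ∀ x : EuclideanSpace ℝ (Fin n), ∀ t ≥ (0:ℝ),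
      HasDerivAt (fun s => φ s x) (f (φ t x)) t)
    (hφsemi : ∀ t ≥ (0:ℝ), ∀ s ≥ (0:ℝ), ∀ x, φ (t + s) x = φ t (φ s x))
    (hφb : ∀ t ≥ (0:ℝ), ∀ y ∈ Metric.closedBall (0 : EuclideanSpace ℝ (Fin n)) (2 * K * r),
      ‖φ t y‖ ≤ K * ‖y‖)
    (hT : 0 < T) (hT1 : T < 2 * K * r / Q) (hT2 : T < 1 / L)
    (N : ℕ) (hN : δ / T < N)
    (k : ℕ) (hck : cval K T L N k < K) :
    ∀ x ∈ Metric.closedBall (0 : EuclideanSpace ℝ (Fin n)) r,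
      ∀ i < N, ∀ t ∈ Set.Icc ((i : ℝ) * T) ((i : ℝ) * T + T), t ≤ δ →
        ‖GIter f T k i (t - i * T) x - φ t x‖ ≤ cval K T L N k * ‖x‖ := by
  intro x hx i hi t ht _
  have hK0 : 0 ≤ K := zero_le_one.trans hK
  rw [mem_closedBall_zero_iff] at hx
  have hball : ∀ g : EuclideanSpace ℝ (Fin n), ‖g‖ ≤ 2 * K * r →
      ∀ t ≥ (0 : ℝ), ‖φ t g‖ ≤ K * ‖g‖ := fun g hg t ht =>
    hφb t ht g (mem_closedBall_zero_iff.2 hg)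
  have hx2 : ‖x‖ ≤ 2 * K * r := by nlinarith
  have hstep : ∀ j < N, ∀ s ∈ Set.Icc 0 T,
      ‖GIter f T k j s x - φ (s + j * T) x‖ ≤ cval K T L (j + 1) k * ‖x‖ := by
    intro j
    induction j with
    | zero =>
      intro _ s hs
      have h := norm_picardT_iterate_sub_flow_le hL.le hfL hφ0 hφd (hball x hx2) x k hs
      rw [sub_self, norm_zero, mul_zero, add_zero] at h
      simp only [GIter, Nat.cast_zero, zero_mul, add_zero, zero_add, cval, Finset.sum_range_one,
        pow_zero, one_mul]
      refine h.trans ?_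
      have h0 : 0 ≤ ‖x‖ * (T * L) ^ k := by positivity
      nlinarith [mul_nonneg (mul_nonneg hK0 (sub_nonneg.2 hK)) h0]
    | succ j ih =>
      intro hj s hs
      have hTj : (0 : ℝ) ≤ T + j * T := by positivity
      have he := ih (by omega) T ⟨hT.le, le_rfl⟩
      set g := GIter f T k j T x
      set z := φ (T + j * T) x with hz
      have hzn : ‖z‖ ≤ K * ‖x‖ := hball x hx2 _ hTj
      have hgn : ‖g‖ ≤ K * ‖x‖ + ‖g - z‖ := by
        linarith [norm_le_norm_add_norm_sub' g z]
      have hcK : cval K T L (j + 1) k ≤ K :=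
        (cval_mono hK0 hT.le hL.le k hj.le).trans hck.le
      have hgball : ‖g‖ ≤ 2 * K * r := by
        nlinarith [mul_le_mul_of_nonneg_right hcK (norm_nonneg x),
          mul_le_mul_of_nonneg_left hx hK0]
      have h := norm_picardT_iterate_sub_flow_le hL.le hfL hφ0 hφd (hball g hgball) z k hs
      have hsemi : φ (s + (j + 1 : ℕ) * T) x = φ s z := by
        rw [hz, ← hφsemi s hs.1 _ hTj]
        push_cast
        ring_nf
      rw [hsemi, cval_succ]
      calc ‖(picardT f)^[k] 0 s g - φ s z‖
          ≤ K * ‖g‖ * (T * L) ^ k + Real.exp (T * L) * ‖g - z‖ := h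
        _ ≤ K * (K * ‖x‖ + ‖g - z‖) * (T * L) ^ k + Real.exp (T * L) * ‖g - z‖ := by gcongr
        _ = (Real.exp (T * L) + K * (T * L) ^ k) * ‖g - z‖ + K ^ 2 * (T * L) ^ k * ‖x‖ := by ring
        _ ≤ (Real.exp (T * L) + K * (T * L) ^ k) * (cval K T L (j + 1) k * ‖x‖) +
            K ^ 2 * (T * L) ^ k * ‖x‖ := by gcongr
        _ = _ := by ring
  have h := hstep i hi (t - i * T) ⟨by linarith [ht.1], by linarith [ht.2]⟩
  rw [sub_add_cancel] at h
  exact h.trans (mul_le_mul_of_nonneg_right (cval_mono hK0 hT.le hL.le k hi) (norm_nonneg x))
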